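/- Let Ω, Ω' ⊆ ℝⁿ be open, F : Ω → Ω' a C² diffeomorphism, A : Ω → (n×n real matrices) a C¹ matrix field, and u : Ω → ℝ a C² function. Then for every x ∈ Ω, ∇·(A∇u)(x) = |det DF(x)| · [∇·((F_*A)∇(u∘F⁻¹))](F(x)). -/

import Mathlib

open Matrix

/-- The gradient of `u : ℝⁿ → ℝ`, as the vector of partial derivatives. -/
noncomputable def pgrad {n : ℕ} (u : (Fin n → ℝ) → ℝ) (x : Fin n → ℝ) : Fin n → ℝ :=
  fun j => fderiv ℝ u x (Pi.single j 1)

/-- The Jacobian matrix `DF = (∂F_i/∂x_j)` of `F : ℝⁿ → ℝⁿ`. -/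
noncomputable def jac {n : ℕ} (F : (Fin n → ℝ) → (Fin n → ℝ)) (x : Fin n → ℝ) :
    Matrix (Fin n) (Fin n) ℝ :=
  Matrix.of fun i j => fderiv ℝ (fun y => F y i) x (Pi.single j 1)

/-- The divergence `∇·V = Σ_j ∂V_j/∂x_j` of a vector field `V : ℝⁿ → ℝⁿ`. -/
noncomputable def pdiv {n : ℕ} (V : (Fin n → ℝ) → (Fin n → ℝ)) (x : Fin n → ℝ) : ℝ :=
  ∑ j, fderiv ℝ (fun y => V y j) x (Pi.single j 1)

/-- The pushforward `F_*A(y) = (DF A DFᵀ)/|det DF| ∘ F⁻¹(y)`, where `G` is the inverse of `F`. -/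
noncomputable def pushf {n : ℕ} (F G : (Fin n → ℝ) → (Fin n → ℝ))
    (A : (Fin n → ℝ) → Matrix (Fin n) (Fin n) ℝ) (y : Fin n → ℝ) :
    Matrix (Fin n) (Fin n) ℝ :=
  |(jac F (G y)).det|⁻¹ • (jac F (G y) * A (G y) * (jac F (G y))ᵀ)

/-- **Jacobi's formula** for the derivative of a determinant. -/
theorem HasFDerivAt.matrix_det {ι E : Type*} [Fintype ι] [DecidableEq ι] [NormedAddCommGroup E]
    [NormedSpace ℝ E] {M : E → Matrix ι ι ℝ} {M' : ι → ι → E →L[ℝ] ℝ} {x : E}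
    (hM : ∀ i j, HasFDerivAt (fun z => M z i j) (M' i j) x) :
    HasFDerivAt (fun z => (M z).det) (∑ i, ∑ j, (M x).adjugate j i • M' i j) x := by
  let D : ContinuousMultilinearMap ℝ (fun _ : ι => ι → ℝ) ℝ :=
    ⟨(detRowAlternating (n := ι) (R := ℝ)).toMultilinearMap,
      Continuous.matrix_det continuous_id⟩
  have hrow : HasFDerivAt (fun z => fun i => M z i)
      (ContinuousLinearMap.pi fun i => ContinuousLinearMap.pi fun j => M' i j) x :=
    hasFDerivAt_pi.2 fun i => hasFDerivAt_pi.2 fun j => hM i j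
  refine ((D.hasFDerivAt (M x)).comp x hrow).congr_fderiv ?_
  ext v
  have hD : ∀ i (h : ι → ℝ), D (Function.update (M x) i h) = ∑ j, (M x).adjugate j i * h j := by
    intro i h
    change ((M x).updateRow i h).det = _
    rw [← cramer_transpose_apply, cramer_eq_adjugate_mulVec, ← adjugate_transpose]
    rfl
  rw [ContinuousLinearMap.comp_apply]
  refine (D.linearDeriv_apply _ _).trans ?_
  simp only [_root_.sum_apply, _root_.smul_apply, smul_eq_mul]
  exact Finset.sum_congr rfl fun i _ => hD i _

theorem HasFDerivAt.abs_inv {E : Type*} [NormedAddCommGroup E] [NormedSpace ℝ E] {d : E → ℝ}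
    {d' : E →L[ℝ] ℝ} {x : E} (hd : HasFDerivAt d d' x) (h0 : d x ≠ 0) :
    HasFDerivAt (fun z => |d z|⁻¹) (-(|d x|⁻¹ * (d x)⁻¹) • d') x := by
  have h' := ((hasDerivAt_abs h0).inv (abs_ne_zero.2 h0)).comp_hasFDerivAt x hd
  refine h'.congr_fderiv ?_
  congr 1
  rcases lt_or_gt_of_ne h0 with h | h
  · simp only [_root_.abs_of_neg h, sign_neg h, SignType.coe_neg_one]
    field_simp
  · simp only [_root_.abs_of_pos h, sign_pos h, SignType.coe_one]
    field_simp

theorem clm_apply_eq_sum_single {n : ℕ} {E : Type*} [NormedAddCommGroup E] [NormedSpace ℝ E]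
    (L : (Fin n → ℝ) →L[ℝ] E) (v : Fin n → ℝ) :
    L v = ∑ i, v i • L (Pi.single i 1) := by
  conv_lhs => rw [pi_eq_sum_univ' v]
  simp only [map_sum, map_smul]

theorem jac_apply {n : ℕ} {F : (Fin n → ℝ) → (Fin n → ℝ)} {x : Fin n → ℝ}
    (hF : DifferentiableAt ℝ F x) (i j : Fin n) :
    jac F x i j = fderiv ℝ F x (Pi.single j 1) i := by
  rw [jac, of_apply, (hasFDerivAt_pi'.1 hF.hasFDerivAt i).fderiv]
  rfl

/-- Chain rule: `DFᵀ ∇(u ∘ G) = ∇u ∘ G` when `G` is a left inverse of `F` to first order. -/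
theorem jac_transpose_mulVec_pgrad_comp {n : ℕ} {F G : (Fin n → ℝ) → (Fin n → ℝ)}
    {u : (Fin n → ℝ) → ℝ} {y : Fin n → ℝ} (hF : DifferentiableAt ℝ F (G y))
    (hG : DifferentiableAt ℝ G y) (hu : DifferentiableAt ℝ u (G y))
    (hGF : ∀ v, fderiv ℝ G y (fderiv ℝ F (G y) v) = v) :
    (jac F (G y))ᵀ *ᵥ pgrad (u ∘ G) y = pgrad u (G y) := by
  ext k
  have h := clm_apply_eq_sum_single ((fderiv ℝ u (G y)).comp (fderiv ℝ G y))
    (fderiv ℝ F (G y) (Pi.single k 1))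
  rw [ContinuousLinearMap.comp_apply, hGF] at h
  simp only [mulVec, dotProduct, transpose_apply, pgrad, jac_apply hF, fderiv_comp y hu hG, h,
    smul_eq_mul]

/-- **Piola identity** for the pullback of a vector field: the divergence of
`|det DF|⁻¹ DF V`, read in the coordinates `F`, is `|det DF|⁻¹ ∇·V`. -/
theorem pdiv_piola {n : ℕ} {F G V : (Fin n → ℝ) → (Fin n → ℝ)} {x : Fin n → ℝ}
    (hF : ContDiffAt ℝ 2 F x) (hG : DifferentiableAt ℝ G (F x)) (hGFx : G (F x) = x)
    (hGF : ∀ v, fderiv ℝ G (F x) (fderiv ℝ F x v) = v)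
    (hJ : (jac F x).det ≠ 0) (hV : DifferentiableAt ℝ V x) :
    pdiv (fun y => |(jac F (G y)).det|⁻¹ • jac F (G y) *ᵥ V (G y)) (F x)
      = |(jac F x).det|⁻¹ * pdiv V x := by
  have hFd : DifferentiableAt ℝ F x := hF.differentiableAt (by norm_num)
  have hFi : ∀ i, ContDiffAt ℝ 2 (fun z => F z i) x := fun i => contDiffAt_pi.1 hF i
  set H : Fin n → (Fin n → ℝ) →L[ℝ] (Fin n → ℝ) →L[ℝ] ℝ :=
    fun i => fderiv ℝ (fderiv ℝ fun z => F z i) x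
  have hsymm : ∀ i v w, H i v w = H i w v := fun i =>
    (hFi i).isSymmSndFDerivAt (by simp)
  have hjac : ∀ i j, HasFDerivAt (fun z => jac F z i j) (H i (Pi.single j 1)) x := by
    intro i j
    have h1 : HasFDerivAt (fderiv ℝ fun z => F z i) (H i) x :=
      (((hFi i).fderiv_right (m := 1) (by norm_num)).differentiableAt (by norm_num)).hasFDerivAt
    refine (h1.clm_apply (hasFDerivAt_const (Pi.single j 1) x)).congr_fderiv ?_
    ext v
    simp [hsymm i v]
  have hVj : ∀ j, HasFDerivAt (fun z => V z j) (fderiv ℝ (fun z => V z j) x) x := fun j =>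
    (differentiableAt_pi.1 hV j).hasFDerivAt
  set g := fderiv ℝ G (F x) with hg
  set J := jac F x with hJdef
  set c := |J.det|⁻¹ with hc
  set D : (Fin n → ℝ) →L[ℝ] ℝ := ∑ a, ∑ b, J.adjugate b a • H a (Pi.single b 1) with hD
  have hdet : HasFDerivAt (fun z => |(jac F z).det|⁻¹) (-(c * J.det⁻¹) • D) x :=
    (HasFDerivAt.matrix_det hjac).abs_inv hJ
  have hJg : ∀ (L : (Fin n → ℝ) →L[ℝ] ℝ) j, ∑ i, J i j * L (g (Pi.single i 1))
      = L (Pi.single j 1) := by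
    intro L j
    have h := clm_apply_eq_sum_single (L.comp g) (fderiv ℝ F x (Pi.single j 1))
    rw [ContinuousLinearMap.comp_apply, hGF] at h
    simp only [h, hJdef, jac_apply hFd, smul_eq_mul, ContinuousLinearMap.comp_apply]
  have hgJ : ∀ (L : (Fin n → ℝ) →L[ℝ] ℝ) a,
      ∑ b, J.adjugate b a * L (Pi.single b 1) = J.det * L (g (Pi.single a 1)) := by
    intro L a
    simp_rw [← hJg L, Finset.mul_sum, ← mul_assoc]
    rw [Finset.sum_comm]
    simp_rw [← Finset.sum_mul, mul_comm (J.adjugate _ _), ← mul_apply, mul_adjugate]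
    simp [one_apply]
  have hterm : ∀ i, fderiv ℝ (fun y => (|(jac F (G y)).det|⁻¹ • jac F (G y) *ᵥ V (G y)) i) (F x)
      (Pi.single i 1) = c * ∑ j, (J i j * fderiv ℝ (fun z => V z j) x (g (Pi.single i 1))
        + V x j * H i (Pi.single j 1) (g (Pi.single i 1)))
        - c * J.det⁻¹ * ∑ j, V x j * (J i j * D (g (Pi.single i 1))) := by
    intro i
    have h1 := hdet.mul (HasFDerivAt.fun_sum (u := Finset.univ)
      fun j _ => (hjac i j).mul (hVj j))
    rw [← hGFx] at h1
    have h2 := h1.comp (F x) hG.hasFDerivAt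
    rw [hGFx] at h2
    have h3 : fderiv ℝ (fun y => (|(jac F (G y)).det|⁻¹ • jac F (G y) *ᵥ V (G y)) i) (F x) = _ :=
      h2.fderiv
    rw [h3]
    simp only [ContinuousLinearMap.comp_apply, _root_.add_apply, _root_.smul_apply,
      _root_.sum_apply, Pi.mul_apply, smul_eq_mul, ← hg, ← hJdef, ← hc,
      Finset.mul_sum, Finset.sum_mul,
      ← Finset.sum_add_distrib, ← Finset.sum_sub_distrib]
    exact Finset.sum_congr rfl fun j _ => by ring
  simp only [pdiv]
  simp_rw [hterm, Finset.sum_sub_distrib, ← Finset.mul_sum, Finset.sum_add_distrib]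
  rw [Finset.sum_comm, Finset.sum_comm (f := fun i j => V x j * (J i j * D (g (Pi.single i 1))))]
  simp_rw [hJg, ← Finset.mul_sum, hJg]
  have hDe : ∀ j, D (Pi.single j 1) = J.det * ∑ i, H i (Pi.single j 1) (g (Pi.single i 1)) := by
    intro j
    simp only [hD, _root_.sum_apply, _root_.smul_apply, smul_eq_mul, Finset.mul_sum, ← hgJ]
    exact Finset.sum_congr rfl fun a _ => Finset.sum_congr rfl fun b _ => by rw [hsymm]
  simp_rw [hDe]
  rw [Finset.sum_comm (f := fun i j => V x j * H i (Pi.single j 1) (g (Pi.single i 1)))]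
  simp only [← Finset.mul_sum, mul_left_comm (V x _) J.det]
  rw [mul_assoc, inv_mul_cancel_left₀ hJ]
  ring

/-- transformation of the divergence-form operator under a C² diffeomorphism:
`∇·(A∇u)(x) = |det DF(x)| · [∇·((F_*A)∇(u∘F⁻¹))](F(x))`. -/
theorem stmt2 {n : ℕ} (Ω Ω' : Set (Fin n → ℝ)) (hΩ : IsOpen Ω) (hΩ' : IsOpen Ω')
    (F G : (Fin n → ℝ) → (Fin n → ℝ))
    (hF : ContDiffOn ℝ 2 F Ω) (hG : ContDiffOn ℝ 2 G Ω')
    (hFbij : Set.BijOn F Ω Ω')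
    (hGF : ∀ x ∈ Ω, G (F x) = x) (hFG : ∀ y ∈ Ω', F (G y) = y)
    (hJ : ∀ x ∈ Ω, (jac F x).det ≠ 0)
    (A : (Fin n → ℝ) → Matrix (Fin n) (Fin n) ℝ)
    (hA : ∀ i j, ContDiffOn ℝ 1 (fun x => A x i j) Ω)
    (u : (Fin n → ℝ) → ℝ) (hu : ContDiffOn ℝ 2 u Ω)
    (x : Fin n → ℝ) (hx : x ∈ Ω) :
    pdiv (fun z => (A z).mulVec (pgrad u z)) x
      = |(jac F x).det| * pdiv (fun y => (pushf F G A y).mulVec (pgrad (u ∘ G) y)) (F x) := by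
  have hy : F x ∈ Ω' := hFbij.mapsTo hx
  have hFx : ∀ z ∈ Ω, ContDiffAt ℝ 2 F z := fun z hz => hF.contDiffAt (hΩ.mem_nhds hz)
  have hux : ∀ z ∈ Ω, ContDiffAt ℝ 2 u z := fun z hz => hu.contDiffAt (hΩ.mem_nhds hz)
  have hFd : ∀ z ∈ Ω, DifferentiableAt ℝ F z := fun z hz =>
    (hFx z hz).differentiableAt (by norm_num)
  have hGd : ∀ z ∈ Ω, DifferentiableAt ℝ G (F z) := fun z hz =>
    (hG.contDiffAt (hΩ'.mem_nhds (hFbij.mapsTo hz))).differentiableAt (by norm_num)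
  have hGF' : ∀ z ∈ Ω, ∀ v, fderiv ℝ G (F z) (fderiv ℝ F z v) = v := by
    intro z hz v
    have h1 : HasFDerivAt (G ∘ F) _ z := (hGd z hz).hasFDerivAt.comp z (hFd z hz).hasFDerivAt
    have h2 : HasFDerivAt (G ∘ F) (ContinuousLinearMap.id ℝ _) z :=
      (hasFDerivAt_id z).congr_of_eventuallyEq
        (Filter.eventuallyEq_of_mem (hΩ.mem_nhds hz) hGF)
    exact DFunLike.congr_fun (h1.unique h2) v
  have hV : DifferentiableAt ℝ (fun z => A z *ᵥ pgrad u z) x := by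
    have hgrad : ∀ j, DifferentiableAt ℝ (fun z => pgrad u z j) x := fun j =>
      (((hux x hx).fderiv_right (m := 1) (by norm_num)).differentiableAt (by norm_num)).clm_apply
        (differentiableAt_const _)
    refine differentiableAt_pi.2 fun i => ?_
    simp only [mulVec, dotProduct]
    refine DifferentiableAt.fun_sum fun j _ => ?_
    exact (((hA i j).contDiffAt (hΩ.mem_nhds hx)).differentiableAt (by norm_num)).mul (hgrad j)
  have hpush : ∀ y ∈ Ω', pushf F G A y *ᵥ pgrad (u ∘ G) y
      = |(jac F (G y)).det|⁻¹ • jac F (G y) *ᵥ (A (G y) *ᵥ pgrad u (G y)) := by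
    intro y hy
    obtain ⟨z, hz, rfl⟩ := hFbij.surjOn hy
    have hGz := hGF z hz
    rw [pushf, smul_mulVec, ← mulVec_mulVec, ← mulVec_mulVec,
      jac_transpose_mulVec_pgrad_comp (hGz.symm ▸ hFd z hz) (hGd z hz)
        (hGz.symm ▸ (hux z hz).differentiableAt (by norm_num)) (hGz.symm ▸ hGF' z hz)]
  have hcongr : pdiv (fun y => pushf F G A y *ᵥ pgrad (u ∘ G) y) (F x)
      = pdiv (fun y => |(jac F (G y)).det|⁻¹ •
          jac F (G y) *ᵥ (A (G y) *ᵥ pgrad u (G y))) (F x) := by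
    refine Finset.sum_congr rfl fun j _ => ?_
    rw [Filter.EventuallyEq.fderiv_eq
      (Filter.eventuallyEq_of_mem (hΩ'.mem_nhds hy) fun y hy => congrFun (hpush y hy) j)]
  rw [hcongr, pdiv_piola (V := fun z => A z *ᵥ pgrad u z) (hFx x hx) (hGd x hx) (hGF x hx)
    (hGF' x hx) (hJ x hx) hV, mul_inv_cancel_left₀ (abs_ne_zero.2 (hJ x hx))]
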